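/- Let n = pq with p and q distinct odd primes, let F be a Reinhardt polynomial for n, and suppose f_1, f_2 ∈ ℤ[z] form a nontrivial decomposition of F: deg f_1 < q, deg f_2 < p, every coefficient of f_1 and f_2 lies in {−1, 0, 1}, F(z) = f_1(z)·Φ_p(−z^q) + f_2(z)·Φ_q(−z^p), f_1 ∉ {0, Φ_q(−z)}, and f_2 ∉ {0, Φ_p(−z)}. Write f_1(z)·Φ_p(−z^q) = Σ_{i=0}^{pq−1} s_i z^i. Then there exist integers i and j with 0 ≤ i < j < pq such that i ≡ j (mod 2), s_i = 1, s_j = 0, and Σ_{k=i+1}^{j−1} |s_k| ≡ 0 (mod 2). -/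

import Mathlib

open Polynomial

/-- The nonzero coefficients of `F`, read in order of increasing degree, alternate in sign:
any two nonzero coefficients with only zero coefficients strictly between them have
opposite signs. -/
def AltSigns (F : Polynomial ℤ) : Prop :=
  ∀ i j : ℕ, i < j → F.coeff i ≠ 0 → F.coeff j ≠ 0 →
    (∀ k, i < k → k < j → F.coeff k = 0) → F.coeff j = -F.coeff i

/-- `F` is a Reinhardt polynomial for `n`: `F(0) = 1`, `deg F < n`, every coefficient lies
in `{-1, 0, 1}`, the nonzero coefficients read in order of increasing degree alternate in
sign beginning and ending with `+1` (so their number is odd), and `Φ_{2n} ∣ F`. -/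
def IsReinhardt (n : ℕ) (F : Polynomial ℤ) : Prop :=
  F.coeff 0 = 1 ∧
  F.degree < (n : WithBot ℕ) ∧
  (∀ k, F.coeff k ∈ ({-1, 0, 1} : Set ℤ)) ∧
  AltSigns F ∧
  (∀ i, F.coeff i ≠ 0 → (∀ k, k < i → F.coeff k = 0) → F.coeff i = 1) ∧
  (∀ i, F.coeff i ≠ 0 → (∀ k, i < k → F.coeff k = 0) → F.coeff i = 1) ∧
  Odd F.support.card ∧
  cyclotomic (2 * n) ℤ ∣ F

/-- The doubled coefficient sequence `u_F : ℤ/2nℤ → ℤ`: `u_F(k)` is the coefficient of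
`z^k` in `F` for `0 ≤ k < n`, and `u_F(n + k) = -u_F(k)` for `0 ≤ k < n`. -/
def uF (n : ℕ) (F : Polynomial ℤ) (k : ZMod (2 * n)) : ℤ :=
  if k.val < n then F.coeff k.val else -F.coeff (k.val - n)

/-- `F` is `m`-antiperiodic: `u_F(k + m) = -u_F(k)` for all `k ∈ ℤ/2nℤ`. -/
def Antiper (n : ℕ) (F : Polynomial ℤ) (m : ℕ) : Prop :=
  ∀ k : ZMod (2 * n), uF n F (k + (m : ZMod (2 * n))) = -uF n F k

/-- `F` is periodic: it is `(n/d)`-antiperiodic for some odd divisor `d > 1` of `n`. -/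
def IsPeriodicR (n : ℕ) (F : Polynomial ℤ) : Prop :=
  ∃ d : ℕ, d ∣ n ∧ Odd d ∧ 1 < d ∧ Antiper n F (n / d)

/-- The `k`-th coefficient of `f(-z)`, extended periodically with period `q` from `k < q`. -/
def signedCoeff (f : Polynomial ℤ) (q k : ℕ) : ℤ := (-1) ^ (k % q) * f.coeff (k % q)

theorem signedCoeff_add_period (f : Polynomial ℤ) (q k : ℕ) :
    signedCoeff f q (k + q) = signedCoeff f q k := by
  simp [signedCoeff]

theorem signedCoeff_congr (f : Polynomial ℤ) {q k l : ℕ} (h : k % q = l % q) :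
    signedCoeff f q k = signedCoeff f q l := by
  simp [signedCoeff, h]

theorem signedCoeff_mem {f : Polynomial ℤ} (hf : ∀ k, f.coeff k ∈ ({-1, 0, 1} : Set ℤ))
    (q k : ℕ) : signedCoeff f q k = -1 ∨ signedCoeff f q k = 0 ∨ signedCoeff f q k = 1 := by
  have h := hf (k % q)
  simp only [Set.mem_insert_iff, Set.mem_singleton_iff] at h
  unfold signedCoeff
  rcases neg_one_pow_eq_or ℤ (k % q) with e | e <;> rw [e] <;> omega

theorem coeff_mul_cyclotomic_comp {p q : ℕ} (hp : p.Prime) (hq : 0 < q) {f : Polynomial ℤ}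
    (hf : f.degree < (q : WithBot ℕ)) {i : ℕ} (hi : i < p * q) :
    (f * (cyclotomic p ℤ).comp (-(X ^ q))).coeff i = (-1) ^ (i / q) * f.coeff (i % q) := by
  have := Fact.mk hp
  have hterm : ∀ a : ℕ, (f * (-(X ^ q)) ^ a).coeff i =
      if q * a ≤ i then (-1) ^ a * f.coeff (i - q * a) else 0 := by
    intro a
    have : f * (-(X ^ q)) ^ a = C ((-1) ^ a) * (f * X ^ (q * a)) := by
      rw [neg_pow, ← pow_mul]
      simp only [map_pow, map_neg, map_one]
      ring
    rw [this, coeff_C_mul, coeff_mul_X_pow']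
    split_ifs <;> simp
  simp only [cyclotomic_prime, Polynomial.sum_comp, X_pow_comp, Finset.mul_sum, finsetSum_coeff,
    hterm]
  have hmod := Nat.div_add_mod i q
  have hlt := Nat.mod_lt i hq
  rw [Finset.sum_eq_single (i / q)]
  · rw [if_pos (by omega)]
    congr 2
    omega
  · intro a _ ha
    split_ifs with h
    · rw [coeff_eq_zero_of_degree_lt (hf.trans_le _), mul_zero]
      have : a < i / q := lt_of_le_of_ne ((Nat.le_div_iff_mul_le hq).2 (by linarith)) ha
      have : q * (a + 1) ≤ q * (i / q) := Nat.mul_le_mul_left q this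
      rw [mul_add] at this
      exact_mod_cast (by omega : q ≤ i - q * a)
    · rfl
  · intro h
    exact absurd (Finset.mem_range.2 ((Nat.div_lt_iff_lt_mul hq).2 hi)) h

theorem coeff_mul_cyclotomic_comp_eq_signedCoeff {p q : ℕ} (hp : p.Prime) (hoq : Odd q)
    {f : Polynomial ℤ} (hf : f.degree < (q : WithBot ℕ)) {i : ℕ} (hi : i < p * q) :
    (f * (cyclotomic p ℤ).comp (-(X ^ q))).coeff i = (-1) ^ i * signedCoeff f q i := by
  rw [coeff_mul_cyclotomic_comp hp hoq.pos hf hi, signedCoeff, ← mul_assoc, ← pow_add]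
  congr 1
  have h : i + i % q = q * (i / q) + 2 * (i % q) := by
    have := Nat.div_add_mod i q
    omega
  rw [h, pow_add, pow_mul, hoq.neg_one_pow, pow_mul]
  simp

theorem exists_signedCoeff_ne_zero {f : Polynomial ℤ} {q : ℕ}
    (hf : f.degree < (q : WithBot ℕ)) (h : f ≠ 0) : ∃ k < q, signedCoeff f q k ≠ 0 := by
  by_contra! hc
  refine h (Polynomial.ext fun k => ?_)
  by_cases hk : k < q
  · simpa [signedCoeff, Nat.mod_eq_of_lt hk] using hc k hk
  · rw [coeff_zero]
    exact coeff_eq_zero_of_degree_lt (hf.trans_le (by exact_mod_cast not_lt.1 hk))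

theorem exists_signedCoeff_ne_one {f : Polynomial ℤ} {q : ℕ} (hq : q.Prime)
    (hf : f.degree < (q : WithBot ℕ)) (h : f ≠ (cyclotomic q ℤ).comp (-X)) :
    ∃ k < q, signedCoeff f q k ≠ 1 := by
  by_contra! hc
  refine h (Polynomial.ext fun k => ?_)
  by_cases hk : k < q
  · have h1 := coeff_mul_cyclotomic_comp (f := 1) (q := 1) (i := k) hq one_pos
      (by rw [degree_one]; norm_num) (by simpa using hk)
    have h2 := hc k hk
    simp only [one_mul, pow_one, Nat.div_one, Nat.mod_one, coeff_one_zero, mul_one] at h1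
    rw [h1]
    rw [signedCoeff, Nat.mod_eq_of_lt hk] at h2
    rcases neg_one_pow_eq_or ℤ k with e | e <;> rw [e] at h2 ⊢ <;> omega
  · rw [coeff_eq_zero_of_degree_lt (hf.trans_le (by exact_mod_cast not_lt.1 hk)),
      coeff_eq_zero_of_natDegree_lt]
    rw [natDegree_comp, natDegree_cyclotomic, natDegree_neg, natDegree_X, mul_one,
      Nat.totient_prime hq]
    have := hq.pos
    omega

/-- If every `i < j < M` of parity `r` with `A i = 1`, `A j = 0` have partial sums of equal
parity, then `A` takes equal values at `k` and `k + 1` for each `k` of parity `r` lying between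
such an `i` and `j`. -/
theorem eq_succ_of_partial_sums_parity {A : ℕ → ℤ} {M r : ℕ} (hA : ∀ k, A k = 0 ∨ A k = 1)
    (H : ∀ i j, i < j → j < M → i % 2 = r → j % 2 = r → A i = 1 → A j = 0 →
      (∑ k ∈ Finset.range i, A k) % 2 = (∑ k ∈ Finset.range j, A k) % 2)
    {i j k : ℕ} (hj : j < M) (hir : i % 2 = r) (hjr : j % 2 = r) (hi1 : A i = 1) (hj0 : A j = 0)
    (hik : i ≤ k) (hkj : k < j) (hkr : k % 2 = r) : A k = A (k + 1) := by
  have hN : ∀ l, i ≤ l → l ≤ j → l % 2 = r →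
      (∑ k ∈ Finset.range l, A k) % 2 = (∑ k ∈ Finset.range i, A k) % 2 := by
    intro l hil hlj hlr
    rcases hil.eq_or_lt with rfl | hil
    · rfl
    rcases hA l with h | h
    · exact (H i l hil (by omega) hir hlr hi1 h).symm
    · have hlj' : l < j := lt_of_le_of_ne hlj (by rintro rfl; omega)
      rw [H l j hlj' hj hlr hjr h hj0, H i j (by omega) hj hir hjr hi1 hj0]
  have h1 := hN k hik hkj.le hkr
  have h2 := hN (k + 2) (by omega) (by omega) (by omega)
  rw [Finset.sum_range_succ, Finset.sum_range_succ] at h2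
  have := hA k
  have := hA (k + 1)
  omega

theorem false_of_even_partial_sums_parity {A : ℕ → ℤ} {M q : ℕ}
    (hA : ∀ k, A k = 0 ∨ A k = 1) (hper : ∀ k, A (k + q) = A k) (hoq : q % 2 = 1)
    (hM : 3 * q ≤ M) (h0 : A 0 = 1) (hne : ∃ x < q, A x ≠ 1)
    (H : ∀ i j, i < j → j < M → i % 2 = 0 → j % 2 = 0 → A i = 1 → A j = 0 →
      (∑ k ∈ Finset.range i, A k) % 2 = (∑ k ∈ Finset.range j, A k) % 2) : False := by
  have key := fun {j k : ℕ} (hj : j < M) hjr hj0 (hkj : k < j) hkr =>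
    eq_succ_of_partial_sums_parity hA H (i := 0) hj rfl hjr h0 hj0 (Nat.zero_le k) hkj hkr
  by_cases hx : ∃ x < q, x % 2 = 0 ∧ A x = 0
  · obtain ⟨x, hxq, hx2, hx0⟩ := hx
    have hj0 : A (x + q + q) = 0 := by rw [hper, hper, hx0]
    have hstep : ∀ m < q, A m = A (m + 1) := by
      intro m hm
      rcases Nat.mod_two_eq_zero_or_one m with h | h
      · exact key (j := x + q + q) (by omega) (by omega) hj0 (by omega) h
      · have h' := key (j := x + q + q) (k := m + q) (by omega) (by omega) hj0 (by omega)
          (by omega)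
        rwa [hper, add_right_comm, hper] at h'
    have hall : ∀ m < q, A m = 1 := by
      intro m
      induction m with
      | zero => exact fun _ => h0
      | succ m ih => exact fun hm => by rw [← hstep m (by omega), ih (by omega)]
    have := hall x hxq
    omega
  · push Not at hx
    obtain ⟨x, hxq, hx1⟩ := hne
    have hx0 : A x = 0 := by have := hA x; omega
    have hx2 : x % 2 = 1 := by
      by_contra h
      exact hx x hxq (by omega) hx0
    obtain ⟨y, rfl⟩ : ∃ y, x = y + 1 := ⟨x - 1, by omega⟩
    have h := key (j := y + 1 + q) (k := y) (by omega) (by omega) (by rw [hper, hx0]) (by omega)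
      (by omega)
    exact hx y (by omega) (by omega) (by omega)

theorem eq_one_of_odd_partial_sums_parity {A : ℕ → ℤ} {M q : ℕ}
    (hA : ∀ k, A k = 0 ∨ A k = 1) (hper : ∀ k, A (k + q) = A k) (hoq : q % 2 = 1) (hq3 : 3 ≤ q)
    (hM : 3 * q ≤ M) (h0 : A 0 = 0) (hne : ∃ x < q, A x ≠ 0)
    (H : ∀ i j, i < j → j < M → i % 2 = 1 → j % 2 = 1 → A i = 1 → A j = 0 →
      (∑ k ∈ Finset.range i, A k) % 2 = (∑ k ∈ Finset.range j, A k) % 2) :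
    M ≤ 3 * q ∧ ∀ m, 0 < m → m < q → A m = 1 := by
  have key := @eq_succ_of_partial_sums_parity A M 1 hA H
  have hq0 : A q = 0 := by simpa [h0] using hper 0
  by_cases hx : ∃ x < q, x % 2 = 1 ∧ A x = 1
  · obtain ⟨x, hxq, hx2, hx1⟩ := hx
    by_cases hy : ∃ y < q, y % 2 = 1 ∧ A y = 0
    · obtain ⟨y, hyq, hy2, hy0⟩ := hy
      have hj0 : A (y + q + q) = 0 := by rw [hper, hper, hy0]
      have hstep : ∀ m, x ≤ m → m < q → A m = A (m + 1) := by
        intro m hxm hm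
        rcases Nat.mod_two_eq_zero_or_one m with h | h
        · have h' := key (i := x) (j := y + q + q) (k := m + q) (by omega) hx2 (by omega) hx1 hj0
            (by omega) (by omega) (by omega)
          rwa [hper, add_right_comm, hper] at h'
        · exact key (i := x) (j := y + q + q) (by omega) hx2 (by omega) hx1 hj0 hxm (by omega) h
      have hall : ∀ m, x ≤ m → m ≤ q → A m = 1 := by
        intro m hxm
        induction m, hxm using Nat.le_induction with
        | base => exact fun _ => hx1
        | succ m hxm ih => exact fun hm => by rw [← hstep m hxm (by omega), ih (by omega)]
      have := hall q hxq.le le_rfl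
      omega
    · push Not at hy
      have hodd : ∀ m < q, m % 2 = 1 → A m = 1 := fun m hm hm2 => by
        have := hA m
        have := hy m hm hm2
        omega
      have h1 := hodd 1 (by omega) rfl
      constructor
      · by_contra! hlt
        have hj0 : A (q + q + q) = 0 := by rw [hper, hper, hq0]
        have h := key (i := 1) (j := q + q + q) (k := q) (by omega) rfl (by omega) h1 hj0
          (by omega) (by omega) hoq
        rw [add_comm q 1, hper] at h
        omega
      · intro m hm hmq
        rcases Nat.mod_two_eq_zero_or_one m with h | h
        · obtain ⟨l, rfl⟩ : ∃ l, m = l + 1 := ⟨m - 1, by omega⟩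
          rw [← key (i := 1) (j := q) (k := l) (by omega) rfl hoq h1 hq0 (by omega) (by omega)
            (by omega)]
          exact hodd l (by omega) (by omega)
        · exact hodd m hmq h
  · exfalso
    push Not at hx
    have hodd : ∀ m < q, m % 2 = 1 → A m = 0 := fun m hm hm2 => by
      have := hA m
      have := hx m hm hm2
      omega
    obtain ⟨x, hxq, hx0⟩ := hne
    have hx1 : A x = 1 := by have := hA x; omega
    have hx2 : x % 2 = 0 := by
      by_contra h
      exact hx x hxq (by omega) hx1
    obtain ⟨y, rfl⟩ : ∃ y, x = y + 1 := ⟨x - 1, by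
      have : x ≠ 0 := by rintro rfl; omega
      omega⟩
    have hi1 : A (y + 1 + q) = 1 := by rw [hper, hx1]
    have hj0 : A (q - 2 + q + q) = 0 := by
      rw [hper, hper]
      exact hodd _ (by omega) (by omega)
    rcases eq_or_ne (y + 2) q with hyq | hyq
    · have h := key (i := y + 1 + q) (j := q - 2 + q + q) (k := y + 1 + q) (by omega) (by omega)
        (by omega) hi1 hj0 le_rfl (by omega) (by omega)
      rw [show y + 1 + q + 1 = q + q by omega, hper, hper] at h
      omega
    · have h := key (i := y + 1 + q) (j := q - 2 + q + q) (k := y + q + q) (by omega) (by omega)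
        (by omega) hi1 hj0 (by omega) (by omega) (by omega)
      rw [show y + q + q + 1 = y + 1 + q + q by omega, hper, hper, hper, hper] at h
      have := hodd y (by omega) (by omega)
      omega

theorem false_of_altSigns_of_three {q : ℕ} (hoq : q % 2 = 1) (hq5 : 5 ≤ q) (hq3 : q % 3 ≠ 0)
    {F : Polynomial ℤ} (hF : AltSigns F) {S T : ℕ → ℤ}
    (hcoeff : ∀ i < 3 * q, F.coeff i = (-1) ^ i * (S i + T i))
    (hSper : ∀ k, S (k + q) = S k) (hS0 : S 0 = 0) (hS : ∀ m, 0 < m → m < q → S m = -1)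
    (hT : ∀ k l, k % 3 = l % 3 → T k = T l) (hT01 : ∀ k, T k = 0 ∨ T k = 1)
    (hT0 : T 0 = 1) (hTne : ∃ k < 3, T k ≠ 1) : False := by
  have hSq : S q = 0 := by simpa [hS0] using hSper 0
  have hSq' : ∀ m, 0 < m → m < q → S (q + m) = -1 := fun m h h' => by
    rw [add_comm, hSper, hS m h h']
  have hev : ∀ i < 3 * q, i % 2 = 0 → F.coeff i = S i + T i := fun i hi h => by
    rw [hcoeff i hi, (Nat.even_iff.2 h).neg_one_pow, one_mul]
  have hod : ∀ i < 3 * q, i % 2 = 1 → F.coeff i = -(S i + T i) := fun i hi h => by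
    rw [hcoeff i hi, (Nat.odd_iff.2 h).neg_one_pow, neg_one_mul]
  have hz : ∀ i < 3 * q, S i + T i = 0 → F.coeff i = 0 := fun i hi h => by
    rw [hcoeff i hi, h, mul_zero]
  have hT1 : T 1 = 1 := by
    by_contra h
    have h1 : T 1 = 0 := by have := hT01 1; omega
    have e0 := hev 0 (by omega) rfl
    have e1 := hod 1 (by omega) rfl
    have := hS 1 one_pos (by omega)
    have := hF 0 1 one_pos (by omega) (by omega) (by omega)
    omega
  have hT2 : T 2 = 0 := by
    obtain ⟨k, hk, hk1⟩ := hTne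
    have := hT01 2
    interval_cases k <;> omega
  rcases (by omega : q % 3 = 1 ∨ q % 3 = 2) with h | h
  · have e0 := hod q (by omega) hoq
    have e1 := hev (q + 1) (by omega) (by omega)
    have t0 := hT q 1 (by omega)
    have t1 := hT (q + 1) 2 (by omega)
    have := hSq' 1 one_pos (by omega)
    have := hF q (q + 1) (by omega) (by omega) (by omega) (by omega)
    omega
  · have e0 := hev (q - 3) (by omega) (by omega)
    have e1 := hev (q + 3) (by omega) (by omega)
    have t0 := hT (q - 3) 2 (by omega)
    have t1 := hT (q + 3) 2 (by omega)
    have s0 := hS (q - 3) (by omega) (by omega)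
    have s1 := hSq' 3 (by omega) (by omega)
    have := hF (q - 3) (q + 3) (by omega) (by omega) (by omega) fun k hk hk' => by
      refine hz k (by omega) ?_
      rcases (by omega : k = q - 2 ∨ k = q - 1 ∨ k = q ∨ k = q + 1 ∨ k = q + 2) with
        rfl | rfl | rfl | rfl | rfl
      · rw [hS _ (by omega) (by omega), hT _ 0 (by omega), hT0]; rfl
      · rw [hS _ (by omega) (by omega), hT _ 1 (by omega), hT1]; rfl
      · rw [hSq, hT _ 2 (by omega), hT2]; rfl
      · rw [hSq' _ (by omega) (by omega), hT _ 0 (by omega), hT0]; rfl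
      · rw [hSq' _ (by omega) (by omega), hT _ 1 (by omega), hT1]; rfl
    omega


/-- Let `n = pq` with `p, q` distinct odd primes, let `F` be a Reinhardt
polynomial for `n`, and let `f₁, f₂` form a nontrivial decomposition of `F`.  Writing
`f₁(z)·Φ_p(-z^q) = Σ_{i=0}^{pq-1} s_i z^i`, there exist `0 ≤ i < j < pq` with `i ≡ j (mod 2)`,
`s_i = 1`, `s_j = 0`, and an even number of nonzero terms between `s_i` and `s_j`. -/
theorem nontrivial_decomposition_parity (p q : ℕ) (hp : p.Prime) (hq : q.Prime) (hop : Odd p)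
    (hoq : Odd q) (hpq : p ≠ q) (F : Polynomial ℤ) (hF : IsReinhardt (p * q) F)
    (f₁ f₂ : Polynomial ℤ)
    (hdeg₁ : f₁.degree < (q : WithBot ℕ)) (hdeg₂ : f₂.degree < (p : WithBot ℕ))
    (hc₁ : ∀ k, f₁.coeff k ∈ ({-1, 0, 1} : Set ℤ))
    (hc₂ : ∀ k, f₂.coeff k ∈ ({-1, 0, 1} : Set ℤ))
    (hdecomp : F = f₁ * (cyclotomic p ℤ).comp (-(X ^ q))
        + f₂ * (cyclotomic q ℤ).comp (-(X ^ p)))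
    (hnt₁ : f₁ ≠ 0) (hnt₁' : f₁ ≠ (cyclotomic q ℤ).comp (-X))
    (hnt₂ : f₂ ≠ 0) (hnt₂' : f₂ ≠ (cyclotomic p ℤ).comp (-X)) :
    ∃ i j : ℕ, i < j ∧ j < p * q ∧ i % 2 = j % 2 ∧
      (f₁ * (cyclotomic p ℤ).comp (-(X ^ q))).coeff i = 1 ∧
      (f₁ * (cyclotomic p ℤ).comp (-(X ^ q))).coeff j = 0 ∧
      (∑ k ∈ Finset.Ioo i j, |(f₁ * (cyclotomic p ℤ).comp (-(X ^ q))).coeff k|) % 2 = 0 := by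
  have hq3 : 3 ≤ q := by
    have := hq.two_le
    have := Nat.odd_iff.1 hoq
    omega
  have hp3 : 3 ≤ p := by
    have := hp.two_le
    have := Nat.odd_iff.1 hop
    omega
  have hM : 3 * q ≤ p * q := Nat.mul_le_mul_right q hp3
  set S := signedCoeff f₁ q with hSdef
  set T := signedCoeff f₂ p with hTdef
  have hs : ∀ i < p * q, (f₁ * (cyclotomic p ℤ).comp (-(X ^ q))).coeff i = (-1) ^ i * S i :=
    fun i hi => coeff_mul_cyclotomic_comp_eq_signedCoeff hp hoq hdeg₁ hi
  have hFc : ∀ i < p * q, F.coeff i = (-1) ^ i * (S i + T i) := fun i hi => by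
    rw [hdecomp, coeff_add, hs i hi,
      coeff_mul_cyclotomic_comp_eq_signedCoeff hq hop hdeg₂ (by rwa [mul_comm]), mul_add]
  have hST : ∀ x y, S x + T y = -1 ∨ S x + T y = 0 ∨ S x + T y = 1 := by
    intro x y
    have hcop : Nat.Coprime q p := (Nat.coprime_primes hq hp).2 hpq.symm
    obtain ⟨hiq, hip⟩ := (Nat.chineseRemainder hcop x y).2
    have hi := Nat.chineseRemainder_lt_mul hcop x y hq.ne_zero hp.ne_zero
    have h := hFc _ (by rwa [mul_comm])
    have hmem := hF.2.2.1 (Nat.chineseRemainder hcop x y)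
    rw [h, show S _ = S x from signedCoeff_congr f₁ hiq,
      show T _ = T y from signedCoeff_congr f₂ hip] at hmem
    simp only [Set.mem_insert_iff, Set.mem_singleton_iff] at hmem
    rcases neg_one_pow_eq_or ℤ (Nat.chineseRemainder hcop x y : ℕ) with e | e <;>
      rw [e] at hmem <;> omega
  have hST0 : S 0 + T 0 = 1 := by
    have := hFc 0 (by omega)
    rw [hF.1] at this
    simpa using this.symm
  have hS := signedCoeff_mem hc₁ q
  have hT := signedCoeff_mem hc₂ p
  rw [← hSdef] at hS
  rw [← hTdef] at hT
  have hSper : ∀ k, S (k + q) = S k := signedCoeff_add_period f₁ q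
  have hA : ∀ k, |S k| = 0 ∨ |S k| = 1 := fun k => by
    rcases hS k with h | h | h <;> simp [h]
  have hAper : ∀ k, |S (k + q)| = |S k| := fun k => by rw [hSper]
  obtain ⟨x₁, hx₁, hSx₁⟩ := exists_signedCoeff_ne_zero hdeg₁ hnt₁
  obtain ⟨x₂, hx₂, hTx₂⟩ := exists_signedCoeff_ne_zero hdeg₂ hnt₂
  obtain ⟨y₁, hy₁, hSy₁⟩ := exists_signedCoeff_ne_one hq hdeg₁ hnt₁'
  rw [← hSdef] at hSx₁ hSy₁
  rw [← hTdef] at hTx₂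
  by_contra! hcon
  have H : ∀ i j, i < j → j < p * q → i % 2 = j % 2 → (-1) ^ i * S i = 1 → S j = 0 →
      (∑ k ∈ Finset.range i, |S k|) % 2 = (∑ k ∈ Finset.range j, |S k|) % 2 := by
    intro i j hij hj hpar hi1 hj0
    have h := hcon i j hij hj hpar (by rw [hs i (by omega), hi1]) (by rw [hs j hj, hj0, mul_zero])
    have hsum : ∑ k ∈ Finset.Ioo i j, |(f₁ * (cyclotomic p ℤ).comp (-(X ^ q))).coeff k| =
        ∑ k ∈ Finset.Ioo i j, |S k| := Finset.sum_congr rfl fun k hk => by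
      rw [hs k ((Finset.mem_Ioo.1 hk).2.trans hj), abs_mul, abs_pow, abs_neg, abs_one, one_pow,
        one_mul]
    rw [hsum] at h
    have hsplit := Finset.sum_range_add_sum_Ico (fun k => |S k|) hij.le
    rw [← Finset.add_sum_Ioo_eq_sum_Ico (f := fun k => |S k|) hij] at hsplit
    have hSi : |S i| = 1 := by
      rcases hA i with h0 | h1
      · simp [abs_eq_zero.1 h0] at hi1
      · exact h1
    omega
  rcases (by have := hS 0; have := hT 0; omega : (S 0 = 1 ∧ T 0 = 0) ∨ (S 0 = 0 ∧ T 0 = 1)) with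
    ⟨hS0, hT0⟩ | ⟨hS0, hT0⟩
  · have hS01 : ∀ k, S k = 0 ∨ S k = 1 := fun k => by
      have := hST k x₂
      have := hST 0 x₂
      have := hT x₂
      have := hS k
      omega
    refine false_of_even_partial_sums_parity hA hAper (Nat.odd_iff.1 hoq) hM (by simp [hS0])
      ⟨y₁, hy₁, fun h => ?_⟩ fun i j hij hj hi2 hj2 hi1 hj0 =>
        H i j hij hj (by omega) ?_ (abs_eq_zero.1 hj0)
    · rcases hS01 y₁ with h' | h'
      · simp [h'] at h
      · exact hSy₁ h'
    · rw [(Nat.even_iff.2 hi2).neg_one_pow, one_mul]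
      rcases hS01 i with h' | h'
      · simp [h'] at hi1
      · exact h'
  · have hS01 : ∀ k, S k = 0 ∨ S k = -1 := fun k => by
      have := hST k 0
      have := hS k
      omega
    have hT01 : ∀ k, T k = 0 ∨ T k = 1 := fun k => by
      have := hST x₁ k
      have := hS01 x₁
      have := hT k
      omega
    obtain ⟨hle, hall⟩ := eq_one_of_odd_partial_sums_parity hA hAper (Nat.odd_iff.1 hoq) hq3 hM
      (by simp [hS0]) ⟨x₁, hx₁, by simpa using hSx₁⟩ fun i j hij hj hi2 hj2 hi1 hj0 =>
        H i j hij hj (by omega) (by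
          rw [(Nat.odd_iff.2 hi2).neg_one_pow]
          rcases hS01 i with h' | h'
          · simp [h'] at hi1
          · simp [h']) (abs_eq_zero.1 hj0)
    obtain rfl : p = 3 := le_antisymm (Nat.le_of_mul_le_mul_right hle hq.pos) hp3
    have hq3' : q % 3 ≠ 0 := fun h =>
      hpq ((Nat.prime_dvd_prime_iff_eq hp hq).1 (Nat.dvd_of_mod_eq_zero h))
    have hodd := Nat.odd_iff.1 hoq
    refine false_of_altSigns_of_three hodd (by omega) hq3' hF.2.2.2.1 hFc hSper hS0
      (fun m hm hmq => ?_) (fun k l h => signedCoeff_congr f₂ h) hT01 hT0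
      (exists_signedCoeff_ne_one hp hdeg₂ hnt₂')
    have := hall m hm hmq
    rcases hS01 m with h' | h'
    · simp [h'] at this
    · exact h'
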